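/- arXiv:1807.04326 — 5 statements merged into one kernel-verified Lean document; each statement's English description precedes it below -/
import Mathlib

section
/- Let G be a countable amenable group acting on a set X and let (F_n)_{n≥1} be a Følner sequence for G (i.e., |sF_n Δ F_n|/|F_n| → 0 for every s ∈ G). Then for every subset A ⊆ X the lower Banach density satisfies D̲(A) = lim_{n→∞} inf_{x∈X} (1/|F_n|)·|{s ∈ F_n : sx ∈ A}| and the upper Banach density satisfies D̄(A) = lim_{n→∞} sup_{x∈X} (1/|F_n|)·|{s ∈ F_n : sx ∈ A}|. -/
open scoped Pointwise
open Set Filter Topology MeasureTheory TopologicalSpace Function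

universe u

section Defs

variable (G : Type*) {X : Type*} [Group G]

/-- The average (1/|F|)·|{s ∈ F : s • x ∈ A}|. -/
noncomputable def avgCount [MulAction G X] (F : Finset G) (A : Set X) (x : X) : ℝ :=
  (({s : G | s ∈ F ∧ s • x ∈ A}).ncard : ℝ) / (F.card : ℝ)

/-- Lower Banach density of a set for an action. -/
noncomputable def lowerDensity [MulAction G X] (A : Set X) : ℝ :=
  ⨆ F : {F : Finset G // F.Nonempty}, ⨅ x : X, avgCount G F.1 A x

/-- Upper Banach density of a set for an action. -/
noncomputable def upperDensity [MulAction G X] (A : Set X) : ℝ :=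
  ⨅ F : {F : Finset G // F.Nonempty}, ⨆ x : X, avgCount G F.1 A x

/-- `F` is `(K,δ)`-invariant: `|KF Δ F| < δ|F|`. -/
def FolnerInv (K : Finset G) (δ : ℝ) (F : Set G) : Prop :=
  ((symmDiff ((K : Set G) * F) F).ncard : ℝ) < δ * F.ncard

/-- Følner characterization of amenability. -/
def IsAmenableGrp : Prop :=
  ∀ (K : Finset G) (δ : ℝ), 0 < δ → ∃ F : Finset G, F.Nonempty ∧ FolnerInv G K δ (F : Set G)

/-- A `G`-invariant Borel probability measure. -/
def InvariantProb [MulAction G X] [MeasurableSpace X] (μ : Measure X) : Prop :=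
  IsProbabilityMeasure μ ∧ ∀ g : G, Measure.map (fun x => g • x) μ = μ

/-- Topologically small subset. -/
def TopSmall [MulAction G X] (A : Set X) : Prop :=
  ∃ L : ℕ, ∀ s : Fin (L + 1) → G, Function.Injective s → (⋂ i, s i • A) = ∅

/-- A castle indexed by `Fin n`: all tower levels are pairwise disjoint. -/
def IsCastle [MulAction G X] {n : ℕ} (V : Fin n → Set X) (S : Fin n → Finset G) : Prop :=
  ∀ (i j : Fin n), ∀ s ∈ S i, ∀ t ∈ S j, (i ≠ j ∨ s ≠ t) → Disjoint (s • V i) (t • V j)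

/-- The union of the levels of a castle. -/
def castleUnion [MulAction G X] {n : ℕ} (V : Fin n → Set X) (S : Fin n → Finset G) : Set X :=
  ⋃ i, ⋃ s ∈ S i, s • V i

/-- Dynamical subequivalence with `m`-tolerance: `A ≺_m B`. -/
def SubEquivM [MulAction G X] [TopologicalSpace X] (m : ℕ) (A B : Set X) : Prop :=
  ∀ C : Set X, IsClosed C → C ⊆ A →
    ∃ (k : ℕ) (U : Fin k → Set X) (g : Fin k → G) (p : Fin k → Fin (m + 1)),
      (∀ i, IsOpen (U i)) ∧ C ⊆ (⋃ i, U i) ∧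
      (∀ i, g i • U i ⊆ B) ∧
      ∀ i j, i ≠ j → p i = p j → Disjoint (g i • U i) (g j • U j)

/-- Dynamical subequivalence `A ≺ B`. -/
def SubEquiv [MulAction G X] [TopologicalSpace X] (A B : Set X) : Prop :=
  SubEquivM G 0 A B

/-- The set of points with singleton fibre. -/
def singFibres {Z X : Type*} (π : Z → X) : Set X := {x | ∃! z, π z = x}

def IsEquivariant {Z X : Type*} [MulAction G Z] [MulAction G X] (π : Z → X) : Prop :=
  ∀ (g : G) (z : Z), π (g • z) = g • π z

/-- The extension `π` is measure-isomorphic over singleton fibres. -/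
def MeasIsoSingFibres {Z X : Type*} [MulAction G Z] [MeasurableSpace Z]
    [MeasurableSpace X] (π : Z → X) : Prop :=
  ∀ μ : Measure Z, InvariantProb G μ → Measure.map π μ (singFibres π) = 1

end Defs

section Defs2

variable (G X : Type*) [Group G]

/-- The small boundary property. -/
def SmallBoundary [MulAction G X] [TopologicalSpace X] [MeasurableSpace X] : Prop :=
  ∃ B : Set (Set X), IsTopologicalBasis B ∧
    ∀ U ∈ B, ∀ μ : Measure X, InvariantProb G μ → μ (frontier U) = 0

/-- The topological small boundary property. -/
def TopSmallBoundary [MulAction G X] [TopologicalSpace X] : Prop :=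
  ∃ B : Set (Set X), IsTopologicalBasis B ∧ ∀ U ∈ B, TopSmall G (frontier U)

/-- Free action. -/
def IsFreeAction [MulAction G X] : Prop :=
  ∀ (g : G) (x : X), g • x = x → g = 1

/-- The action is by homeomorphisms (continuous action of a discrete group). -/
def ContinuousAction [MulAction G X] [TopologicalSpace X] : Prop :=
  ∀ g : G, Continuous (fun x : X => g • x)

/-- Zero-dimensionality: a basis of clopen sets. -/
def ZeroDim [TopologicalSpace X] : Prop :=
  ∃ B : Set (Set X), @IsTopologicalBasis X _ B ∧ ∀ U ∈ B, IsClopen U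

/-- Almost finiteness in measure. -/
def AlmostFiniteInMeasure [MulAction G X] [MetricSpace X] : Prop :=
  ∀ (K : Finset G) (δ ε : ℝ), 0 < δ → 0 < ε →
    ∃ (n : ℕ) (V : Fin n → Set X) (S : Fin n → Finset G),
      IsCastle G V S ∧ (∀ i, IsOpen (V i)) ∧
      (∀ i, ∀ s ∈ S i, Metric.diam (s • V i) < δ) ∧
      (∀ i, FolnerInv G K δ ((S i : Set G))) ∧
      1 - ε ≤ lowerDensity G (castleUnion G V S)

/-- `m`-comparison. -/
def HasMComparison [MulAction G X] [TopologicalSpace X] [MeasurableSpace X] (m : ℕ) : Prop :=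
  ∀ A B : Set X, IsOpen A → IsOpen B → A.Nonempty → B.Nonempty →
    (∀ μ : Measure X, InvariantProb G μ → μ A < μ B) → SubEquivM G m A B

/-- Almost finiteness. -/
def AlmostFinite [MulAction G X] [MetricSpace X] : Prop :=
  ∀ (N : ℕ) (K : Finset G) (δ : ℝ), 0 < N → 0 < δ →
    ∃ (n : ℕ) (V : Fin n → Set X) (S S' : Fin n → Finset G),
      IsCastle G V S ∧ (∀ i, IsOpen (V i)) ∧
      (∀ i, ∀ s ∈ S i, Metric.diam (s • V i) < δ) ∧
      (∀ i, FolnerInv G K δ ((S i : Set G))) ∧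
      (∀ i, S' i ⊆ S i ∧ ((S' i).card : ℝ) < ((S i).card : ℝ) / (N : ℝ)) ∧
      SubEquiv G (Set.univ \ castleUnion G V S) (castleUnion G V S')

end Defs2

lemma bd_avg {G X : Type*} [Group G] [MulAction G X] (F : Finset G) (A : Set X) (x : X) :
    avgCount G F A x = (∑ s ∈ F, A.indicator (fun _ => (1:ℝ)) (s • x)) / (F.card : ℝ) := by
  classical
  unfold avgCount
  congr 1
  have h : {s : G | s ∈ F ∧ s • x ∈ A} = ((F.filter (fun s => s • x ∈ A) : Finset G) : Set G) := by
    ext s; simp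
  rw [h, Set.ncard_coe_finset, Finset.card_filter]
  push_cast
  refine Finset.sum_congr rfl fun s _ => ?_
  simp [Set.indicator_apply]

lemma bd_nonneg {G X : Type*} [Group G] [MulAction G X] (F : Finset G) (A : Set X) (x : X) :
    0 ≤ avgCount G F A x := by unfold avgCount; positivity

lemma bd_le_one {G X : Type*} [Group G] [MulAction G X] (F : Finset G) (A : Set X) (x : X) :
    avgCount G F A x ≤ 1 := by
  rw [bd_avg]
  refine div_le_one_of_le₀ ?_ (by positivity)
  refine (Finset.sum_le_card_nsmul _ _ 1 ?_).trans (by simp)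
  intro s _
  exact Set.indicator_le_self' (by simp) _ |>.trans le_rfl

lemma bd_diff {G : Type*} [DecidableEq G] (S T : Finset G) (g : G → ℝ)
    (h0 : ∀ s, 0 ≤ g s) (h1 : ∀ s, g s ≤ 1) :
    |∑ s ∈ S, g s - ∑ s ∈ T, g s| ≤ ((symmDiff (S : Set G) (T : Set G)).ncard : ℝ) := by
  have hs : symmDiff (S : Set G) (T : Set G) = ((symmDiff S T : Finset G) : Set G) := by
    simp
  rw [hs, Set.ncard_coe_finset]
  have hc : (symmDiff S T).card = (S \ T).card + (T \ S).card := by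
    rw [symmDiff_def, Finset.sup_eq_union, Finset.card_union_of_disjoint]
    exact disjoint_sdiff_sdiff
  have b : ∀ U : Finset G, 0 ≤ ∑ s ∈ U, g s ∧ ∑ s ∈ U, g s ≤ (U.card : ℝ) := fun U =>
    ⟨Finset.sum_nonneg fun s _ => h0 s,
      (Finset.sum_le_card_nsmul _ _ 1 fun s _ => h1 s).trans (by simp)⟩
  rw [← Finset.sum_sdiff_sub_sum_sdiff, hc, abs_le]
  push_cast
  have := b (S \ T)
  have := b (T \ S)
  constructor <;> linarith

lemma bd_key {G X : Type*} [Group G] [MulAction G X] (E F : Finset G) (hE : E.Nonempty)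
    (hF : F.Nonempty) (A : Set X) (x : X) :
    |(∑ t ∈ F, avgCount G E A (t • x)) / F.card - avgCount G F A x| ≤
      (∑ e ∈ E, ((symmDiff (e • (F : Set G)) (F : Set G)).ncard : ℝ) / (F.card : ℝ)) / E.card := by
  classical
  have hE' : (0:ℝ) < E.card := by exact_mod_cast hE.card_pos
  have hF' : (0:ℝ) < F.card := by exact_mod_cast hF.card_pos
  simp only [bd_avg]
  set f : X → ℝ := A.indicator (fun _ => (1:ℝ)) with hf
  have f0 : ∀ y, 0 ≤ f y := fun y => Set.indicator_nonneg (by simp) _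
  have f1 : ∀ y, f y ≤ 1 := fun y => Set.indicator_le_self' (by simp) _
  have e1 : (∑ t ∈ F, (∑ s ∈ E, f (s • t • x)) / (E.card:ℝ)) / (F.card:ℝ)
      - (∑ s ∈ F, f (s • x)) / (F.card:ℝ)
      = (∑ e ∈ E, (∑ t ∈ F, f (e • t • x) - ∑ t ∈ F, f (t • x)) / (F.card:ℝ)) / (E.card:ℝ) := by
    rw [← Finset.sum_div, ← Finset.sum_div, Finset.sum_sub_distrib, Finset.sum_comm,
      Finset.sum_const, nsmul_eq_mul]
    field_simp
  rw [e1, abs_div, abs_of_pos hE']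
  gcongr
  refine (Finset.abs_sum_le_sum_abs _ _).trans (Finset.sum_le_sum fun e _ => ?_)
  rw [abs_div, abs_of_pos hF']
  gcongr
  have h := bd_diff (e • F) F (fun s => f (s • x)) (fun _ => f0 _) (fun _ => f1 _)
  rw [Finset.coe_smul_finset] at h
  refine le_trans (le_of_eq ?_) h
  congr 2
  rw [Finset.smul_finset_def, Finset.sum_image (by intro a _ b _ h; simpa using h)]
  simp [mul_smul]

theorem banach_density_along_folner_sequence
    {G X : Type*} [Group G] [Countable G] [MulAction G X]
    (F : ℕ → Finset G) (hne : ∀ n, (F n).Nonempty)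
    (hFolner : ∀ s : G, Tendsto
      (fun n => ((symmDiff (s • ((F n : Set G))) ((F n : Set G))).ncard : ℝ) / ((F n).card : ℝ))
      atTop (𝓝 0))
    (A : Set X) :
    Tendsto (fun n => ⨅ x : X, avgCount G (F n) A x) atTop (𝓝 (lowerDensity G A)) ∧
    Tendsto (fun n => ⨆ x : X, avgCount G (F n) A x) atTop (𝓝 (upperDensity G A)) := by
  have bb : ∀ E : Finset G, BddBelow (range fun x : X => avgCount G E A x) := fun E =>
    ⟨0, by rintro _ ⟨x, rfl⟩; exact bd_nonneg E A x⟩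
  have ba : ∀ E : Finset G, BddAbove (range fun x : X => avgCount G E A x) := fun E =>
    ⟨1, by rintro _ ⟨x, rfl⟩; exact bd_le_one E A x⟩
  have i0 : ∀ E : Finset G, ⨅ x : X, avgCount G E A x ≤ 1 := fun E => by
    rcases isEmpty_or_nonempty X with h | ⟨⟨x⟩⟩
    · simp [Real.iInf_of_isEmpty]
    · exact (ciInf_le (bb E) x).trans (bd_le_one E A x)
  have s0 : ∀ E : Finset G, 0 ≤ ⨆ x : X, avgCount G E A x := fun E =>
    Real.iSup_nonneg fun x => bd_nonneg E A x
  have Ba : BddAbove (range fun E : {F : Finset G // F.Nonempty} => ⨅ x : X, avgCount G E.1 A x) :=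
    ⟨1, by rintro _ ⟨E, rfl⟩; exact i0 E.1⟩
  have Bb : BddBelow (range fun E : {F : Finset G // F.Nonempty} => ⨆ x : X, avgCount G E.1 A x) :=
    ⟨0, by rintro _ ⟨E, rfl⟩; exact s0 E.1⟩
  haveI : Nonempty {F : Finset G // F.Nonempty} := ⟨⟨F 0, hne 0⟩⟩
  have hd : ∀ E : Finset G, Tendsto (fun n => (∑ e ∈ E,
      ((symmDiff (e • (F n : Set G)) (F n : Set G)).ncard : ℝ) / ((F n).card : ℝ)) / E.card)
      atTop (𝓝 0) := fun E => by
    have := (tendsto_finsetSum E fun e _ => hFolner e).div_const (E.card : ℝ)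
    simpa using this
  have hpos : ∀ n, (0:ℝ) < (F n).card := fun n => by exact_mod_cast (hne n).card_pos
  rcases isEmpty_or_nonempty X with hX | hX
  · simp [lowerDensity, upperDensity, Real.iInf_of_isEmpty, Real.iSup_of_isEmpty]
  constructor
  · refine tendsto_order.2 ⟨fun a ha => ?_, fun a ha => Eventually.of_forall fun n =>
      (le_ciSup Ba ⟨F n, hne n⟩).trans_lt ha⟩
    obtain ⟨⟨E, hE⟩, h⟩ := exists_lt_of_lt_ciSup ha
    filter_upwards [(hd E).eventually_lt_const (sub_pos.2 h)] with n hn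
    refine lt_of_lt_of_le (lt_sub_comm.1 hn) (le_ciInf fun x => ?_)
    have k := (abs_le.1 (bd_key E (F n) hE (hne n) A x)).2
    have : ⨅ x : X, avgCount G E A x ≤ (∑ t ∈ F n, avgCount G E A (t • x)) / (F n).card := by
      rw [le_div_iff₀ (hpos n), mul_comm, ← nsmul_eq_mul]
      exact Finset.card_nsmul_le_sum _ _ _ fun t _ => ciInf_le (bb E) (t • x)
    linarith
  · refine tendsto_order.2 ⟨fun a ha => Eventually.of_forall fun n =>
      ha.trans_le (ciInf_le Bb ⟨F n, hne n⟩), fun a ha => ?_⟩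
    obtain ⟨⟨E, hE⟩, h⟩ := exists_lt_of_ciInf_lt ha
    filter_upwards [(hd E).eventually_lt_const (sub_pos.2 h)] with n hn
    refine lt_of_le_of_lt (ciSup_le fun x => ?_) (lt_sub_iff_add_lt'.1 hn)
    have k := (abs_le.1 (bd_key E (F n) hE (hne n) A x)).1
    have : (∑ t ∈ F n, avgCount G E A (t • x)) / (F n).card ≤ ⨆ x : X, avgCount G E A x := by
      rw [div_le_iff₀ (hpos n), mul_comm, ← nsmul_eq_mul]
      exact Finset.sum_le_card_nsmul _ _ _ fun t _ => le_ciSup (ba E) (t • x)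
    linarith
end

section
/- Let G be a countable amenable group acting continuously on a compact metrizable space X with compatible metric d, and let A ⊆ X be closed. Then for every ε > 0 there exists δ > 0 such that the set A_+ = {x ∈ X : d(x,A) ≤ δ} satisfies D̄(A_+) ≤ D̄(A) + ε. -/
open scoped Pointwise
open Set Filter Topology MeasureTheory TopologicalSpace Function

universe u

theorem upper_density_of_closed_neighbourhood
    {G X : Type*} [Group G] [Countable G] [MulAction G X]
    [MetricSpace X] [CompactSpace X]
    (hG : IsAmenableGrp G) (hc : ContinuousAction G X)
    (A : Set X) (hA : IsClosed A) (ε : ℝ) (hε : 0 < ε) :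
    ∃ δ : ℝ, 0 < δ ∧
      upperDensity G {x : X | EMetric.infEdist x A ≤ ENNReal.ofReal δ} ≤
        upperDensity G A + ε := by
  classical
  have hnn : ∀ (F : Finset G) (B : Set X) (x : X), 0 ≤ avgCount G F B x := fun F B x => by
    unfold avgCount; positivity
  have hle1 : ∀ (F : Finset G) (B : Set X) (x : X), avgCount G F B x ≤ 1 := fun F B x => by
    unfold avgCount
    apply div_le_one_of_le₀ _ (by positivity)
    have : ({s : G | s ∈ F ∧ s • x ∈ B}).ncard ≤ (F : Set G).ncard :=
      Set.ncard_le_ncard (fun s hs => hs.1) F.finite_toSet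
    rw [Set.ncard_coe_finset] at this
    exact_mod_cast this
  haveI : Nonempty {F : Finset G // F.Nonempty} := ⟨⟨{1}, by simp⟩⟩
  obtain ⟨F, hF⟩ := exists_lt_of_ciInf_lt
    (show (⨅ F : {F : Finset G // F.Nonempty}, ⨆ x : X, avgCount G F.1 A x)
      < upperDensity G A + ε from lt_add_of_pos_right _ hε)
  have hbdd : BddAbove (Set.range fun x : X => avgCount G F.1 A x) :=
    ⟨1, by rintro _ ⟨x, rfl⟩; exact hle1 _ _ _⟩
  have key : ∀ᶠ δ : ℝ in 𝓝[>] (0 : ℝ), ∀ y ∈ (Set.univ : Set X),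
      avgCount G F.1 {x : X | EMetric.infEdist x A ≤ ENNReal.ofReal δ} y
        ≤ ⨆ x : X, avgCount G F.1 A x := by
    have h0 : ∀ᶠ δ : ℝ in 𝓝 (0 : ℝ), ∀ y ∈ (Set.univ : Set X),
      avgCount G F.1 {x : X | EMetric.infEdist x A ≤ ENNReal.ofReal δ} y
        ≤ ⨆ x : X, avgCount G F.1 A x := by
      apply isCompact_univ.eventually_forall_of_forall_eventually
      intro x _
      have h1 : ∀ s ∈ F.1, ∀ᶠ z : ℝ × X in 𝓝 ((0 : ℝ), x), s • x ∉ A →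
          ENNReal.ofReal z.1 < EMetric.infEdist (s • z.2) A := by
        intro s _
        by_cases hs : s • x ∈ A
        · exact Eventually.of_forall fun z h => absurd hs h
        · have hpos : ENNReal.ofReal ((0 : ℝ), x).1
              < EMetric.infEdist (s • ((0 : ℝ), x).2) A := by
            simp only [ENNReal.ofReal_zero]
            rw [pos_iff_ne_zero]
            intro h
            exact hs ((Metric.mem_iff_infEDist_zero_of_closed hA).2 h)
          have hcs := hc s
          have c1 : Continuous fun z : ℝ × X => ENNReal.ofReal z.1 :=
            ENNReal.continuous_ofReal.comp continuous_fst
          have c2 : Continuous fun z : ℝ × X => EMetric.infEdist (s • z.2) A :=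
            Metric.continuous_infEDist.comp (hcs.comp continuous_snd)
          filter_upwards [(c1.tendsto ((0 : ℝ), x)).eventually_lt
            (c2.tendsto ((0 : ℝ), x)) hpos] with z hz _ using hz
      filter_upwards [(Filter.eventually_all_finset F.1).2 h1] with z hz
      refine le_trans ?_ (le_ciSup hbdd x)
      unfold avgCount
      refine div_le_div_of_nonneg_right (Nat.cast_le.2 (Set.ncard_le_ncard ?_ ?_))
        (Nat.cast_nonneg _)
      · rintro s ⟨hs, hs'⟩
        refine ⟨hs, ?_⟩
        by_contra h
        exact absurd hs' (not_le.2 (hz s hs h))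
      · exact F.1.finite_toSet.subset fun s hs => hs.1
    exact h0.filter_mono nhdsWithin_le_nhds
  obtain ⟨δ, hδ, hpos⟩ := (key.and self_mem_nhdsWithin).exists
  refine ⟨δ, hpos, le_trans ?_ hF.le⟩
  refine le_trans (ciInf_le ⟨0, ?_⟩ F) ?_
  · rintro _ ⟨F', rfl⟩
    exact Real.iSup_nonneg fun x => hnn _ _ _
  · exact Real.iSup_le (fun y => hδ y (Set.mem_univ y)) (Real.iSup_nonneg fun x => hnn _ _ _)
end

section
/- Let Z and X be compact metrizable spaces, π : Z → X a continuous surjection, and S_π = {x ∈ X : π^{-1}(x) is a singleton}. For any Borel probability measure μ on Z, the following are equivalent: (i) π_*μ(S_π) = 1; (ii) there is a basis ℬ for the topology on Z such that π_*μ(π(U) ∩ π(Z∖U)) = 0 for every U ∈ ℬ; (iii) π_*μ(π(U) ∩ π(Z∖U)) = 0 for every open set U ⊆ Z; (iv) π_*μ(π(C₁) ∩ π(C₂)) = 0 for every pair of disjoint closed sets C₁, C₂ ⊆ Z; (v) π_*μ(π(C)) = μ(C) for every closed set C ⊆ Z; (vi) π_*μ(π(U)) = μ(U) for every open set U ⊆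 Z. -/
open scoped Pointwise
open Set Filter Topology MeasureTheory TopologicalSpace Function

universe u

theorem aux_singFibres_compl {Z X : Type*} (π : Z → X) (A B : Set Z) (h : Disjoint A B) :
    π '' A ∩ π '' B ⊆ (singFibres π)ᶜ := by
  rintro x ⟨⟨a, ha, rfl⟩, ⟨b, hb, hab⟩⟩ hx
  have : b = a := hx.unique hab rfl
  subst this
  exact h.le_bot ⟨ha, hb⟩

theorem aux_compl_subset {Z X : Type*} [TopologicalSpace Z] [T1Space Z] (π : Z → X)
    (hπs : Function.Surjective π) (B : Set (Set Z)) (hB : IsTopologicalBasis B) :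
    (singFibres π)ᶜ ⊆ ⋃ U ∈ B, π '' U ∩ π '' Uᶜ := by
  intro x hx
  obtain ⟨z, rfl⟩ := hπs x
  have : ∃ w, π w = π z ∧ w ≠ z := by
    by_contra! hcon
    exact hx ⟨z, rfl, hcon⟩
  obtain ⟨w, hw, hne⟩ := this
  obtain ⟨U, hU, hzU, hsub⟩ := hB.exists_subset_of_mem_open
    (show z ∈ ({w}ᶜ : Set Z) from fun h => hne h.symm) isOpen_compl_singleton
  refine mem_biUnion hU ⟨⟨z, hzU, rfl⟩, ⟨w, fun h => hsub h rfl, hw⟩⟩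

theorem aux_exists_closed {Z : Type*} [TopologicalSpace Z] [MetrizableSpace Z] {U : Set Z}
    (hU : IsOpen U) : ∃ F : ℕ → Set Z, (∀ n, IsClosed (F n)) ∧ ⋃ n, F n = U := by
  letI := metrizableSpaceMetric Z
  obtain ⟨F, h1, _, h3, _⟩ := hU.exists_iUnion_isClosed
  exact ⟨F, h1, h3⟩

theorem pushforward_full_on_singleton_fibres_tfae
    {Z X : Type*}
    [TopologicalSpace Z] [CompactSpace Z] [MetrizableSpace Z]
    [MeasurableSpace Z] [BorelSpace Z]
    [TopologicalSpace X] [CompactSpace X] [MetrizableSpace X]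
    [MeasurableSpace X] [BorelSpace X]
    (π : Z → X) (hπc : Continuous π) (hπs : Function.Surjective π)
    (μ : Measure Z) [IsProbabilityMeasure μ] :
    List.TFAE [
      Measure.map π μ (singFibres π) = 1,
      ∃ B : Set (Set Z), IsTopologicalBasis B ∧
        ∀ U ∈ B, Measure.map π μ (π '' U ∩ π '' Uᶜ) = 0,
      ∀ U : Set Z, IsOpen U → Measure.map π μ (π '' U ∩ π '' Uᶜ) = 0,
      ∀ C₁ C₂ : Set Z, IsClosed C₁ → IsClosed C₂ → Disjoint C₁ C₂ →
        Measure.map π μ (π '' C₁ ∩ π '' C₂) = 0,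
      ∀ C : Set Z, IsClosed C → Measure.map π μ (π '' C) = μ C,
      ∀ U : Set Z, IsOpen U → Measure.map π μ (π '' U) = μ U ] := by
  letI := metrizableSpaceMetric Z
  have hπm : Measurable π := hπc.measurable
  haveI : IsProbabilityMeasure (Measure.map π μ) :=
    Measure.isProbabilityMeasure_map hπm.aemeasurable
  have mC : ∀ C : Set Z, IsClosed C → MeasurableSet (π '' C) := fun C hC =>
    (hC.isCompact.image hπc).measurableSet
  have mU : ∀ U : Set Z, IsOpen U → MeasurableSet (π '' U) := by
    intro U hU
    obtain ⟨F, hF, rfl⟩ := aux_exists_closed hU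
    rw [image_iUnion]
    exact MeasurableSet.iUnion fun n => mC _ (hF n)
  have mUU : ∀ U : Set Z, IsOpen U → MeasurableSet (π '' U ∩ π '' Uᶜ) := fun U hU =>
    (mU U hU).inter (mC _ hU.isClosed_compl)
  have mS : MeasurableSet (singFibres π) := by
    have hb := isBasis_countableBasis Z
    have : (singFibres π)ᶜ = ⋃ U ∈ countableBasis Z, π '' U ∩ π '' Uᶜ :=
      Subset.antisymm (aux_compl_subset π hπs _ hb)
        (iUnion₂_subset fun U _ => aux_singFibres_compl π _ _ disjoint_compl_right)
    rw [← MeasurableSet.compl_iff, this]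
    exact MeasurableSet.biUnion (countable_countableBasis Z) fun U hU => mUU U (hb.isOpen hU)
  have key : ∀ A : Set Z, MeasurableSet A → MeasurableSet (π '' A) →
      (Measure.map π μ (π '' A) = μ A ↔ μ (π ⁻¹' (π '' A) \ A) = 0) := by
    intro A hA hA'
    rw [Measure.map_apply hπm hA',
      measure_sdiff (subset_preimage_image π A) hA.nullMeasurableSet (measure_ne_top _ _),
      tsub_eq_zero_iff_le]
    exact ⟨fun h => h.le, fun h => le_antisymm h (measure_mono (subset_preimage_image π A))⟩
  have s0 : Measure.map π μ (singFibres π) = 1 → Measure.map π μ (singFibres π)ᶜ = 0 :=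
    fun h => (prob_compl_eq_zero_iff mS).2 h
  tfae_have 1 → 3 := fun h U _ =>
    measure_mono_null (aux_singFibres_compl π _ _ disjoint_compl_right) (s0 h)
  tfae_have 3 → 2 := fun h => ⟨_, isTopologicalBasis_opens, fun U hU => h U hU⟩
  tfae_have 2 → 1 := by
    rintro ⟨B, hB, h⟩
    obtain ⟨B', hsub, hc, hB'⟩ := hB.exists_countable
    refine (prob_compl_eq_zero_iff mS).1 (measure_mono_null (aux_compl_subset π hπs _ hB') ?_)
    exact (measure_biUnion_null_iff hc).2 fun U hU => h U (hsub hU)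
  tfae_have 1 → 4 := fun h C₁ C₂ _ _ hd =>
    measure_mono_null (aux_singFibres_compl π _ _ hd) (s0 h)
  tfae_have 4 → 5 := by
    intro h C hC
    rw [key C hC.measurableSet (mC C hC)]
    obtain ⟨F, hF, hFC⟩ := aux_exists_closed hC.isOpen_compl
    have hn : ∀ n, μ (π ⁻¹' (π '' C ∩ π '' (F n))) = 0 := by
      intro n
      rw [← Measure.map_apply hπm ((mC C hC).inter (mC _ (hF n)))]
      refine h C (F n) hC (hF n) ?_
      exact disjoint_compl_right.mono_right (hFC ▸ subset_iUnion F n)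
    refine measure_mono_null ?_ (measure_iUnion_null hn)
    rintro z ⟨hz, hzC⟩
    rw [← mem_compl_iff, ← hFC] at hzC
    obtain ⟨n, hn⟩ := mem_iUnion.1 hzC
    exact mem_iUnion.2 ⟨n, hz, z, hn, rfl⟩
  tfae_have 5 → 6 := by
    intro h U hU
    rw [key U hU.measurableSet (mU U hU)]
    obtain ⟨F, hF, hFU⟩ := aux_exists_closed hU
    refine measure_mono_null ?_ (measure_iUnion_null fun n =>
      (key (F n) (hF n).measurableSet (mC _ (hF n))).1 (h _ (hF n)))
    rintro z ⟨⟨w, hw, hwz⟩, hzU⟩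
    rw [← hFU] at hw hzU
    obtain ⟨n, hn⟩ := mem_iUnion.1 hw
    exact mem_iUnion.2 ⟨n, ⟨w, hn, hwz⟩, fun hz => hzU (mem_iUnion.2 ⟨n, hz⟩)⟩
  tfae_have 6 → 3 := by
    intro h U hU
    rw [Measure.map_apply hπm (mUU U hU)]
    have h1 := (key U hU.measurableSet (mU U hU)).1 (h U hU)
    obtain ⟨F, hF, hFU⟩ := aux_exists_closed hU
    have h2 := measure_iUnion_null fun n =>
      (key (F n)ᶜ (hF n).measurableSet.compl (mU _ (hF n).isOpen_compl)).1
        (h _ (hF n).isOpen_compl)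
    refine measure_mono_null ?_ (measure_union_null h1 h2)
    rintro z ⟨hz1, ⟨w, hw, hwz⟩⟩
    by_cases hzU : z ∈ U
    · right
      rw [← hFU] at hzU
      obtain ⟨n, hn⟩ := mem_iUnion.1 hzU
      refine mem_iUnion.2 ⟨n, ⟨w, fun hwF => hw ?_, hwz⟩, fun hz => hz hn⟩
      rw [← hFU]
      exact mem_iUnion.2 ⟨n, hwF⟩
    · exact Or.inl ⟨hz1, hzU⟩
  tfae_finish
end

section
/- Let G be a countable group, let G ↷ Z and G ↷ X be continuous actions on compact metrizable spaces, and let π : Z → X be a factor map (continuous equivariant surjection). The following are equivalent: (i) π is measure-isomorphic over singleton fibres; (ii) there is a basis ℬ for the topology on Z such that π_*μ(π(U) ∩ π(Z∖U)) = 0 for every U ∈ ℬ and every μ ∈ M_G(Z); (iii) π_*μ(π(U) ∩ π(Z∖U)) = 0 for every open U ⊆ Z and every μ ∈ M_G(Z); (iv) π_*μ(π(C₁) ∩ π(C₂)) = 0 for every pair of disjoint closed sets C₁, C₂ ⊆ Z and every μ ∈ M_G(Z); (v) π_*μ(π(C)) = μ(C) for every closed C ⊆ Z and every μ ∈ M_G(Z);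 (vi) π_*μ(π(U)) = μ(U) for every open U ⊆ Z and every μ ∈ M_G(Z). -/
open scoped Pointwise
open Set Filter Topology MeasureTheory TopologicalSpace Function

universe u

theorem aux_meas_image_open {Z X : Type*}
    [TopologicalSpace Z] [CompactSpace Z] [MetrizableSpace Z]
    [TopologicalSpace X] [T2Space X]
    [MeasurableSpace X] [BorelSpace X]
    (π : Z → X) (hπc : Continuous π) (U : Set Z) (hU : IsOpen U) :
    MeasurableSet (π '' U) := by
  letI := metrizableSpaceMetric Z
  obtain ⟨F, hFc, -, hFU, -⟩ := hU.exists_iUnion_isClosed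
  rw [← hFU, image_iUnion]
  exact MeasurableSet.iUnion fun n => ((hFc n).isCompact.image hπc).isClosed.measurableSet

theorem aux_compl_singFibres {Z X : Type*} [TopologicalSpace Z] [T1Space Z]
    (π : Z → X) (hπs : Function.Surjective π) (B : Set (Set Z)) (hB : IsTopologicalBasis B) :
    (singFibres π)ᶜ = ⋃ U ∈ B, (π '' U ∩ π '' Uᶜ) := by
  ext x
  simp only [mem_compl_iff, mem_iUnion, exists_prop]
  constructor
  · intro hx
    obtain ⟨z, hz⟩ := hπs x
    have : ∃ z', π z' = x ∧ z' ≠ z := by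
      by_contra! h
      exact hx ⟨z, hz, h⟩
    obtain ⟨z', hz', hne⟩ := this
    obtain ⟨U, hUB, hzU, hU⟩ := hB.exists_subset_of_mem_open
      (show z ∈ ({z'} : Set Z)ᶜ from fun h => hne h.symm) isOpen_compl_singleton
    exact ⟨U, hUB, ⟨z, hzU, hz⟩, ⟨z', fun h => hU h rfl, hz'⟩⟩
  · rintro ⟨U, -, ⟨a, ha, hax⟩, ⟨b, hb, hbx⟩⟩ ⟨z, -, hz⟩
    exact hb ((hz b hbx).trans (hz a hax).symm ▸ ha)

theorem aux_sat {Z X : Type*} [MeasurableSpace Z] [MeasurableSpace X]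
    (π : Z → X) (hπ : Measurable π) (μ : Measure Z) (A : Set Z) (hA : MeasurableSet (π '' A))
    (h : Measure.map π μ (π '' A ∩ π '' Aᶜ) = 0) :
    Measure.map π μ (π '' A) = μ A := by
  rw [Measure.map_apply hπ hA]
  apply le_antisymm _ (measure_mono (subset_preimage_image π A))
  have h0 : μ (π ⁻¹' (π '' A ∩ π '' Aᶜ)) = 0 :=
    le_antisymm ((Measure.le_map_apply hπ.aemeasurable _).trans h.le) zero_le
  calc μ (π ⁻¹' (π '' A)) ≤ μ (A ∪ π ⁻¹' (π '' A ∩ π '' Aᶜ)) := by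
        apply measure_mono
        intro z hz
        by_cases hzA : z ∈ A
        · exact Or.inl hzA
        · exact Or.inr ⟨hz, z, hzA, rfl⟩
    _ ≤ μ A + μ (π ⁻¹' (π '' A ∩ π '' Aᶜ)) := measure_union_le _ _
    _ = μ A := by rw [h0, add_zero]

theorem aux_disj {Z X : Type*} [MeasurableSpace Z] [MeasurableSpace X]
    (π : Z → X) (μ : Measure Z) [IsFiniteMeasure μ] (A B : Set Z)
    (hmB : MeasurableSet B) (hB : MeasurableSet (π '' B)) (hd : Disjoint A B)
    (h1 : Measure.map π μ (π '' A) = μ A) (h2 : Measure.map π μ (π '' B) = μ B)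
    (h3 : Measure.map π μ (π '' (A ∪ B)) = μ (A ∪ B)) :
    Measure.map π μ (π '' A ∩ π '' B) = 0 := by
  have h := measure_union_add_inter (μ := Measure.map π μ) (π '' A) hB
  rw [← image_union, h3, h1, h2, measure_union hd hmB] at h
  refine (ENNReal.add_right_inj ?_).1 (h.trans (add_zero _).symm)
  exact ENNReal.add_ne_top.2 ⟨measure_ne_top _ _, measure_ne_top _ _⟩

theorem measure_isomorphic_over_singleton_fibres_tfae
    {G Z X : Type*} [Group G] [Countable G]
    [TopologicalSpace Z] [CompactSpace Z] [MetrizableSpace Z]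
    [MeasurableSpace Z] [BorelSpace Z]
    [TopologicalSpace X] [CompactSpace X] [MetrizableSpace X]
    [MeasurableSpace X] [BorelSpace X]
    [MulAction G Z] [MulAction G X]
    (hcZ : ContinuousAction G Z) (hcX : ContinuousAction G X)
    (π : Z → X) (hπc : Continuous π) (hπs : Function.Surjective π)
    (hπe : IsEquivariant G π) :
    List.TFAE [
      MeasIsoSingFibres G π,
      ∃ B : Set (Set Z), IsTopologicalBasis B ∧
        ∀ U ∈ B, ∀ μ : Measure Z, InvariantProb G μ →
          Measure.map π μ (π '' U ∩ π '' Uᶜ) = 0,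
      ∀ U : Set Z, IsOpen U → ∀ μ : Measure Z, InvariantProb G μ →
        Measure.map π μ (π '' U ∩ π '' Uᶜ) = 0,
      ∀ C₁ C₂ : Set Z, IsClosed C₁ → IsClosed C₂ → Disjoint C₁ C₂ →
        ∀ μ : Measure Z, InvariantProb G μ →
          Measure.map π μ (π '' C₁ ∩ π '' C₂) = 0,
      ∀ C : Set Z, IsClosed C → ∀ μ : Measure Z, InvariantProb G μ →
        Measure.map π μ (π '' C) = μ C,
      ∀ U : Set Z, IsOpen U → ∀ μ : Measure Z, InvariantProb G μ →
        Measure.map π μ (π '' U) = μ U ] := by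
  have hm : Measurable π := hπc.measurable
  have hop := aux_meas_image_open π hπc
  have hcl : ∀ C : Set Z, IsClosed C → MeasurableSet (π '' C) := fun C hC =>
    (hC.isCompact.image hπc).isClosed.measurableSet
  letI := metrizableSpaceMetric Z
  tfae_have 1 → 3 := by
    intro h U hU μ hμ
    haveI := hμ.1
    haveI : IsProbabilityMeasure (Measure.map π μ) := Measure.isProbabilityMeasure_map hm.aemeasurable
    have hS := aux_compl_singFibres π hπs _ (isBasis_countableBasis Z)
    have hSm : MeasurableSet (singFibres π) := by
      rw [← MeasurableSet.compl_iff, hS]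
      refine MeasurableSet.biUnion (countable_countableBasis Z) fun V hV => ?_
      have hVo := isOpen_of_mem_countableBasis hV
      exact (hop V hVo).inter (hcl _ hVo.isClosed_compl)
    have h0 : Measure.map π μ (singFibres π)ᶜ = 0 := (prob_compl_eq_zero_iff hSm).2 (h μ hμ)
    refine measure_mono_null ?_ h0
    rw [aux_compl_singFibres π hπs _ isTopologicalBasis_opens]
    exact subset_biUnion_of_mem (u := fun U => π '' U ∩ π '' Uᶜ) hU
  tfae_have 3 → 2 := fun h => ⟨_, isTopologicalBasis_opens, h⟩
  tfae_have 2 → 1 := by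
    rintro ⟨B, hB, h⟩ μ hμ
    haveI := hμ.1
    haveI : IsProbabilityMeasure (Measure.map π μ) := Measure.isProbabilityMeasure_map hm.aemeasurable
    obtain ⟨B', hB'B, hB'c, hB'⟩ := hB.exists_countable
    have h0 : Measure.map π μ (singFibres π)ᶜ = 0 := by
      rw [aux_compl_singFibres π hπs _ hB', measure_biUnion_null_iff hB'c]
      exact fun U hU => h U (hB'B hU) μ hμ
    apply le_antisymm prob_le_one
    calc (1 : ENNReal) = Measure.map π μ (singFibres π ∪ (singFibres π)ᶜ) := by
          rw [union_compl_self, measure_univ]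
      _ ≤ _ := measure_union_le _ _
      _ = _ := by rw [h0, add_zero]
  tfae_have 4 → 3 := by
    intro h U hU μ hμ
    obtain ⟨F, hFc, hFs, hFU, -⟩ := hU.exists_iUnion_isClosed
    have : π '' U ∩ π '' Uᶜ = ⋃ n, (π '' F n ∩ π '' Uᶜ) := by
      rw [← iUnion_inter, ← image_iUnion, hFU]
    rw [this, measure_iUnion_null_iff]
    exact fun n => h _ _ (hFc n) hU.isClosed_compl
      (disjoint_compl_right.mono_left (hFs n)) μ hμ
  tfae_have 3 → 5 := by
    intro h C hC μ hμ
    refine aux_sat π hm μ C (hcl C hC) ?_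
    have := h Cᶜ hC.isOpen_compl μ hμ
    rwa [compl_compl, inter_comm] at this
  tfae_have 3 → 6 := fun h U hU μ hμ => aux_sat π hm μ U (hop U hU) (h U hU μ hμ)
  tfae_have 5 → 4 := by
    intro h A B hA hB hd μ hμ
    haveI := hμ.1
    exact aux_disj π μ A B hB.measurableSet (hcl B hB) hd (h A hA μ hμ) (h B hB μ hμ)
      (h _ (hA.union hB) μ hμ)
  tfae_have 6 → 4 := by
    intro h A' B' hA' hB' hd' μ hμ
    haveI := hμ.1
    obtain ⟨A, B, hA, hB, hAA, hBB, hd⟩ := SeparatedNhds.of_isCompact_isClosed hA'.isCompact hB' hd'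
    refine measure_mono_null (inter_subset_inter (image_mono hAA) (image_mono hBB)) ?_
    exact aux_disj π μ A B hB.measurableSet (hop B hB) hd (h A hA μ hμ) (h B hB μ hμ)
      (h _ (hA.union hB) μ hμ)
  tfae_finish
end

section
/- Let G be a countable group, X a zero-dimensional compact metrizable space with compatible metric, and G ↷ X a free continuous action. Let Y ⊆ X be clopen, S ⊆ G finite, 0 < ε < 1/2, and δ > 0. Then there is a clopen castle {(V_i,S_i)}_{i=1}^n with levels of diameter less than δ such that: (i) S_i ⊆ S and |S_i| ≥ (1−ε)|S| for every i = 1,…,n, and (ii) the set A = ⨆_{i=1}^n S_iV_i satisfies Y ∩ A = ∅, Y ∪ A = Y ∪ ⋃_{i=1}^n SV_i, and |(Y ∪ A) ∩ Sx| ≥ ε|S| for all x ∈ X. -/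
open scoped Pointwise
open Set Filter Topology MeasureTheory TopologicalSpace Function

universe u

namespace CastleAux

open Classical in
/-- the elements of `S` moving `x` outside `B` -/
noncomputable def TT {G X : Type*} [Group G] [MulAction G X] (S : Finset G) (B : Set X) (x : X) :
    Finset G := S.filter (fun s => s • x ∉ B)

/-- bases of the new towers -/
def VV {G X : Type*} [Group G] [MulAction G X] (S : Finset G) (U B : Set X) (T : Finset G) :
    Set X := U ∩ {x | TT S B x = T}

/-- the sets exhausted so far -/
noncomputable def BB {G X : Type*} [Group G] [MulAction G X] (S : Finset G) (c : ℝ) (Y : Set X)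
    (U : ℕ → Set X) : ℕ → Set X
  | 0 => Y
  | j + 1 => BB S c Y U j ∪
      ⋃ T ∈ S.powerset.filter (fun T => c ≤ (T.card : ℝ)), ⋃ s ∈ T,
        s • VV S (U j) (BB S c Y U j) T

variable {G X : Type*} [Group G] [MulAction G X]

theorem smul_clopen [TopologicalSpace X] (hc : ContinuousAction G X) (s : G) {V : Set X}
    (hV : IsClopen V) : IsClopen (s • V) := by
  have := hV.preimage (hc s⁻¹)
  have h2 : (fun x : X => s⁻¹ • x) ⁻¹' V = s • V := by
    ext x; simp [Set.mem_smul_set_iff_inv_smul_mem]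
  rwa [h2] at this

theorem VV_clopen [TopologicalSpace X] (hc : ContinuousAction G X) (S : Finset G) {U B : Set X}
    (hU : IsClopen U) (hB : IsClopen B) {T : Finset G} (hT : T ⊆ S) : IsClopen (VV S U B T) := by
  classical
  refine hU.inter ?_
  have h : {x : X | TT S B x = T} =
      ⋂ s ∈ S, (if s ∈ T then ((fun x : X => s • x) ⁻¹' B)ᶜ else (fun x : X => s • x) ⁻¹' B) := by
    ext x
    simp only [Set.mem_ofPred_eq, Set.mem_iInter, TT, Finset.ext_iff, Finset.mem_filter]
    constructor
    · intro h s hs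
      have := h s
      split_ifs with h1 <;> simp <;> tauto
    · intro h s
      by_cases hs : s ∈ S
      · have := h s hs
        split_ifs at this with h1
        · simp at this; tauto
        · simp at this; tauto
      · have := @hT s; tauto
  rw [h]
  refine Set.Finite.isClopen_biInter S.finite_toSet ?_
  intro s _
  split_ifs
  · exact (hB.preimage (hc s)).compl
  · exact hB.preimage (hc s)

theorem BB_clopen [TopologicalSpace X] (hc : ContinuousAction G X) (S : Finset G) (c : ℝ)
    {Y : Set X} (hY : IsClopen Y) {U : ℕ → Set X} (hU : ∀ j, IsClopen (U j)) (j : ℕ) :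
    IsClopen (BB S c Y U j) := by
  induction j with
  | zero => exact hY
  | succ j ih =>
    refine ih.union (isClopen_biUnion_finset fun T hT => isClopen_biUnion_finset fun s _ => ?_)
    refine smul_clopen hc s (VV_clopen hc S (hU j) ih ?_)
    simp at hT; exact hT.1

theorem BB_mono (S : Finset G) (c : ℝ) (Y : Set X) (U : ℕ → Set X) : Monotone (BB S c Y U) :=
  monotone_nat_of_le_succ fun _ => Set.subset_union_left

theorem exists_nhd [MetricSpace X]
    (hzd : ZeroDim X) (hfree : IsFreeAction G X) (hc : ContinuousAction G X) (S : Finset G)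
    {δ : ℝ} (hδ : 0 < δ) (x : X) :
    ∃ W : Set X, IsClopen W ∧ x ∈ W ∧ (∀ s ∈ S, Metric.diam (s • W) < δ) ∧
      ∀ s ∈ S, ∀ t ∈ S, s ≠ t → Disjoint (s • W) (t • W) := by
  have h1 : ∀ᶠ η : ℝ in 𝓝[>] 0, 0 < η := self_mem_nhdsWithin
  have key : ∀ r : ℝ, 0 < r → ∀ᶠ η : ℝ in 𝓝[>] 0, η < r := fun r hr =>
    nhdsWithin_le_nhds (gt_mem_nhds hr)
  have h2 : ∀ᶠ η : ℝ in 𝓝[>] 0, ∀ s ∈ S, ∀ t ∈ S, s ≠ t → η < dist (s • x) (t • x) / 2 := by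
    rw [Filter.eventually_all_finset]; intro s _
    rw [Filter.eventually_all_finset]; intro t _
    by_cases hst : s = t
    · simp [hst]
    · have : s • x ≠ t • x := by
        intro h
        apply hst
        have := hfree (t⁻¹ * s) x (by rw [mul_smul, h, inv_smul_smul])
        rwa [inv_mul_eq_one, eq_comm] at this
      filter_upwards [key _ (half_pos (dist_pos.2 this))] with η hη _ using hη
  obtain ⟨η, ⟨h1, h2⟩, h3⟩ := ((h1.and h2).and (key (δ / 3) (by positivity))).exists
  obtain ⟨𝓑, hB, hcl⟩ := hzd
  have hO : IsOpen (⋂ s ∈ S, (fun y : X => s • y) ⁻¹' Metric.ball (s • x) η) :=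
    isOpen_biInter_finset fun s _ => Metric.isOpen_ball.preimage (hc s)
  obtain ⟨W, hW, hxW, hWs⟩ := hB.exists_subset_of_mem_open
    (show x ∈ _ by simp [h1]) hO
  have hb : ∀ s ∈ S, s • W ⊆ Metric.ball (s • x) η := by
    rintro s hs _ ⟨y, hy, rfl⟩
    have := hWs hy
    simp only [Set.mem_iInter] at this
    exact this s hs
  refine ⟨W, hcl W hW, hxW, fun s hs => ?_, fun s hs t ht hst => ?_⟩
  · have := (Metric.diam_mono (hb s hs) Metric.isBounded_ball).trans (Metric.diam_ball h1.le)
    linarith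
  · refine (Metric.ball_disjoint_ball ?_).mono (hb s hs) (hb t ht)
    have := h2 s hs t ht hst
    linarith

theorem exists_cover [MetricSpace X] [CompactSpace X]
    (hzd : ZeroDim X) (hfree : IsFreeAction G X) (hc : ContinuousAction G X) (S : Finset G)
    {δ : ℝ} (hδ : 0 < δ) :
    ∃ (m : ℕ) (U : ℕ → Set X), (∀ j, IsClopen (U j)) ∧ (∀ x, ∃ j < m, x ∈ U j) ∧
      (∀ j, ∀ s ∈ S, Metric.diam (s • U j) < δ) ∧
      ∀ j, ∀ s ∈ S, ∀ t ∈ S, s ≠ t → Disjoint (s • U j) (t • U j) := by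
  choose W hW hx hd hdis using exists_nhd hzd hfree hc S hδ
  obtain ⟨t, ht⟩ := isCompact_univ.elim_finite_subcover W (fun x => (hW x).isOpen)
    (fun x _ => Set.mem_iUnion.2 ⟨x, hx x⟩)
  refine ⟨t.card, fun j => if h : j < t.card then W (t.equivFin.symm ⟨j, h⟩) else ∅, ?_, ?_, ?_, ?_⟩
  · intro j; dsimp only; split_ifs
    · exact hW _
    · exact isClopen_empty
  · intro x
    obtain ⟨y, hy, hxy⟩ := Set.mem_iUnion₂.1 (ht (Set.mem_univ x))
    refine ⟨t.equivFin ⟨y, hy⟩, (t.equivFin ⟨y, hy⟩).2, ?_⟩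
    simpa using hxy
  · intro j; dsimp only; split_ifs
    · exact hd _
    · simpa using fun _ _ => hδ
  · intro j; dsimp only; split_ifs
    · exact hdis _
    · simp

end CastleAux

open CastleAux in
theorem clopen_castle_lemma
    {G X : Type*} [Group G] [Countable G] [MulAction G X]
    [MetricSpace X] [CompactSpace X]
    (hzd : ZeroDim X) (hfree : IsFreeAction G X) (hc : ContinuousAction G X)
    (Y : Set X) (hY : IsClopen Y) (S : Finset G)
    (ε δ : ℝ) (hε0 : 0 < ε) (hε : ε < 1/2) (hδ : 0 < δ) :
    ∃ (n : ℕ) (V : Fin n → Set X) (Sh : Fin n → Finset G),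
      IsCastle G V Sh ∧ (∀ i, IsClopen (V i)) ∧
      (∀ i, ∀ s ∈ Sh i, Metric.diam (s • V i) < δ) ∧
      (∀ i, Sh i ⊆ S ∧ (1 - ε) * (S.card : ℝ) ≤ ((Sh i).card : ℝ)) ∧
      Y ∩ castleUnion G V Sh = ∅ ∧
      Y ∪ castleUnion G V Sh = Y ∪ (⋃ i, ⋃ s ∈ S, s • V i) ∧
      ∀ x : X, ε * (S.card : ℝ) ≤
        (({s : G | s ∈ S ∧ s • x ∈ Y ∪ castleUnion G V Sh}).ncard : ℝ) := by
  classical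
  obtain ⟨m, U, hU, hcov, hdiam, hdis⟩ := exists_cover hzd hfree hc S hδ
  set c : ℝ := (1 - ε) * (S.card : ℝ) with hcdef
  set P := S.powerset.filter (fun T => c ≤ (T.card : ℝ)) with hP
  let B := BB S c Y U
  have hBm : Monotone B := BB_mono S c Y U
  have hBc : ∀ j, IsClopen (B j) := BB_clopen hc S c hY hU
  let W : ℕ → Finset G → Set X := fun j T => VV S (U j) (B j) T
  have hmemP : ∀ T, T ∈ P ↔ T ⊆ S ∧ c ≤ (T.card : ℝ) := by simp [hP]
  -- levels avoid earlier sets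
  have hav : ∀ j T s x, s ∈ T → x ∈ W j T → s • x ∉ B j := by
    rintro j T s x hs ⟨-, hx⟩
    have hx : TT S (B j) x = T := hx
    rw [← hx] at hs
    exact (Finset.mem_filter.1 hs).2
  have hin : ∀ j T s x, T ∈ P → s ∈ T → x ∈ W j T → s • x ∈ B (j + 1) := by
    intro j T s x hT hs hx
    exact Or.inr (Set.mem_iUnion₂.2 ⟨T, hT, Set.mem_iUnion₂.2 ⟨s, hs, Set.smul_mem_smul_set hx⟩⟩)
  have hout : ∀ j T s x, s ∈ S → s ∉ T → x ∈ W j T → s • x ∈ B j := by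
    rintro j T s x hsS hs ⟨-, hx⟩
    have hx : TT S (B j) x = T := hx
    rw [← hx] at hs
    by_contra h
    exact hs (Finset.mem_filter.2 ⟨hsS, h⟩)
  let e : Fin (Fintype.card (Fin m × P)) ≃ Fin m × P := (Fintype.equivFin _).symm
  let V : Fin (Fintype.card (Fin m × P)) → Set X := fun i => W (e i).1 (e i).2
  let Sh : Fin (Fintype.card (Fin m × P)) → Finset G := fun i => (e i).2
  have hShP : ∀ i, Sh i ∈ P := fun i => (e i).2.2
  have hmemA : ∀ y, y ∈ castleUnion G V Sh ↔ ∃ j < m, ∃ T ∈ P, ∃ s ∈ T, ∃ x ∈ W j T, s • x = y := by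
    intro y
    simp only [castleUnion, Set.mem_iUnion, Set.mem_smul_set]
    constructor
    · rintro ⟨i, s, hs, x, hx, rfl⟩
      exact ⟨(e i).1, (e i).1.2, _, hShP i, s, hs, x, hx, rfl⟩
    · rintro ⟨j, hj, T, hT, s, hs, x, hx, rfl⟩
      refine ⟨e.symm (⟨j, hj⟩, ⟨T, hT⟩), s, ?_, x, ?_, rfl⟩
      · simpa [Sh] using hs
      · simpa [V] using hx
  have hBA : ∀ k ≤ m, B k ⊆ Y ∪ castleUnion G V Sh := by
    intro k
    induction k with
    | zero => intro _; exact Set.subset_union_left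
    | succ k ih =>
      rintro hk y (hy | hy)
      · exact ih (by omega) hy
      · obtain ⟨T, hT, hy⟩ := Set.mem_iUnion₂.1 hy
        obtain ⟨s, hs, x, hx, rfl⟩ := Set.mem_iUnion₂.1 hy
        exact Or.inr ((hmemA _).2 ⟨k, by omega, T, hT, s, hs, x, hx, rfl⟩)
  refine ⟨_, V, Sh, ?_, ?_, ?_, ?_, ?_, ?_, ?_⟩
  · intro i i' s hs t ht hne
    rw [Set.disjoint_left]
    rintro _ ⟨x, hx, rfl⟩ ⟨y, hy, hyx⟩
    have hyx : t • y = s • x := hyx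
    rcases lt_trichotomy ((e i).1 : ℕ) (e i').1 with h | h | h
    · have := hin _ _ s x (hShP i) hs hx
      exact hav _ _ t y ht hy (hyx ▸ hBm h this)
    · have hsS := ((hmemP _).1 (hShP i)).1 hs
      have htS := ((hmemP _).1 (hShP i')).1 ht
      have hx1 : x ∈ U (e i).1 := hx.1
      have hy1 : y ∈ U (e i).1 := by rw [h]; exact hy.1
      by_cases hst : s = t
      · subst hst
        have hxy : y = x := smul_left_cancel s hyx
        subst hxy
        have a : TT S (B (e i).1) y = Sh i := hx.2
        have b : TT S (B (e i').1) y = Sh i' := hy.2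
        rw [h, b] at a
        have : e i = e i' := Prod.ext (Fin.ext h) (Subtype.ext a.symm)
        simp [e.injective this] at hne
      · exact Set.disjoint_left.1 (hdis _ s hsS t htS hst) (Set.smul_mem_smul_set hx1)
          (hyx ▸ Set.smul_mem_smul_set hy1)
    · have := hin _ _ t y (hShP i') ht hy
      exact hav _ _ s x hs hx (hyx ▸ hBm h this)
  · intro i
    exact VV_clopen hc S (hU _) (hBc _) ((hmemP _).1 (hShP i)).1
  · intro i s hs
    refine (Metric.diam_mono (Set.smul_set_mono Set.inter_subset_left) ?_).trans_lt
      (hdiam (e i).1 s (((hmemP _).1 (hShP i)).1 hs))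
    exact Metric.isBounded_of_compactSpace
  · exact fun i => (hmemP _).1 (hShP i)
  · rw [Set.eq_empty_iff_forall_notMem]
    rintro y ⟨hyY, hy⟩
    obtain ⟨j, hj, T, hT, s, hs, x, hx, rfl⟩ := (hmemA y).1 hy
    exact hav j T s x hs hx (hBm (Nat.zero_le j) hyY)
  · apply subset_antisymm
    · refine Set.union_subset_union_right _ ?_
      intro y hy
      simp only [castleUnion, Set.mem_iUnion] at hy ⊢
      obtain ⟨i, s, hs, hy⟩ := hy
      exact ⟨i, s, ((hmemP _).1 (hShP i)).1 hs, hy⟩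
    · refine Set.union_subset Set.subset_union_left ?_
      intro y hy
      simp only [Set.mem_iUnion] at hy
      obtain ⟨i, s, hs, x, hx, rfl⟩ := hy
      by_cases h : s ∈ Sh i
      · exact hBA _ (e i).1.2 (hin _ _ s x (hShP i) h hx)
      · exact hBA _ (e i).1.2.le (hout _ _ s x hs h hx)
  · intro x
    obtain ⟨j, hj, hxj⟩ := hcov x
    set D := Y ∪ castleUnion G V Sh with hD
    have hset : {s : G | s ∈ S ∧ s • x ∈ D} = (S.filter (fun s => s • x ∈ D) : Finset G) := by
      ext; simp
    rw [hset, Set.ncard_coe_finset]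
    have hxW : x ∈ W j (TT S (B j) x) := ⟨hxj, rfl⟩
    by_cases hT : TT S (B j) x ∈ P
    · have : S.filter (fun s => s • x ∈ D) = S := by
        refine Finset.filter_true_of_mem fun s hs => ?_
        by_cases h : s ∈ TT S (B j) x
        · exact hBA _ hj (hin _ _ s x hT h hxW)
        · exact hBA _ hj.le (hout _ _ s x hs h hxW)
      rw [this]
      have : (0 : ℝ) ≤ S.card := Nat.cast_nonneg _
      nlinarith
    · have h1 : ((TT S (B j) x).card : ℝ) < c := by
        by_contra h
        exact hT ((hmemP _).2 ⟨Finset.filter_subset _ _, not_lt.1 h⟩)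
      have h2 : S.filter (fun s => s • x ∈ B j) ⊆ S.filter (fun s => s • x ∈ D) :=
        Finset.monotone_filter_right _ fun s _ hs => hBA _ hj.le hs
      have h3 := Finset.card_le_card h2
      have h4 : (S.filter (fun s => s • x ∈ B j)).card + (TT S (B j) x).card = S.card :=
        Finset.card_filter_add_card_filter_not _
      have h3' : ((S.filter (fun s => s • x ∈ B j)).card : ℝ) ≤
        (S.filter (fun s => s • x ∈ D)).card := by exact_mod_cast h3
      have h4' : ((S.filter (fun s => s • x ∈ B j)).card : ℝ) + (TT S (B j) x).card = S.card := by
        exact_mod_cast h4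
      rw [hcdef] at h1
      linarith
end
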